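/- arXiv:hep-th/0606177 — 5 statements merged into one kernel-verified Lean document; each statement's English description precedes it below -/
import Mathlib

section
/- Let 1 < γ₀ < γ̄ and set I = [γ₀, γ̄]. Suppose g : (0,∞) → ℝ satisfies g(1) ≠ 0, and η : I → ℝ is continuous, and for every γ ∈ I and every x > 0 one has g(γ·x) = γ^{η(γ)} · g(x). Then η is constant on I. -/
/-- Iterating the scaling relation `g (c * x) = k * g x` along the powers of `c`. -/
theorem map_pow_of_scaling {g : ℝ → ℝ} {c k : ℝ} (hc : 0 < c)
    (h : ∀ x : ℝ, 0 < x → g (c * x) = k * g x) (n : ℕ) : g (c ^ n) = k ^ n * g 1 := by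
  induction n with
  | zero => simp
  | succ n ih => rw [pow_succ', h _ (pow_pos hc n), ih, pow_succ']; ring

/-- Scaling exponents at two scales having a common positive power coincide. -/
theorem scaling_exponent_eq_of_pow_eq {g : ℝ → ℝ} (hg : g 1 ≠ 0) {c d s t : ℝ}
    (hc : 1 < c) (hd : 1 < d)
    (hcs : ∀ x : ℝ, 0 < x → g (c * x) = c ^ s * g x)
    (hdt : ∀ x : ℝ, 0 < x → g (d * x) = d ^ t * g x)
    {m n : ℕ} (hm : m ≠ 0) (hmn : c ^ m = d ^ n) : s = t := by
  have hc0 : 0 < c := one_pos.trans hc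
  have hd0 : 0 < d := one_pos.trans hd
  have h := map_pow_of_scaling hc0 hcs m
  rw [hmn, map_pow_of_scaling hd0 hdt n] at h
  have h' := mul_right_cancel₀ hg h
  rw [← Real.rpow_mul_natCast hd0.le, ← Real.rpow_mul_natCast hc0.le, mul_comm t, mul_comm s,
    Real.rpow_natCast_mul hd0.le, Real.rpow_natCast_mul hc0.le, hmn] at h'
  have h1 : 1 < d ^ n := hmn ▸ one_lt_pow₀ hc hm
  rw [← Real.logb_rpow (one_pos.trans h1) h1.ne' (x := s), ← h',
    Real.logb_rpow (one_pos.trans h1) h1.ne']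

/-- If `g : (0,∞) → ℝ` satisfies `g(γ·x) = γ^{η(γ)}·g(x)` for all `γ` in an interval
`I = [γ₀, γ̄]` with `1 < γ₀ < γ̄` and all `x > 0`, `g 1 ≠ 0`, and `η` is continuous on `I`,
then `η` is constant on `I`. -/
theorem stmt_0 (γ₀ γbar : ℝ) (hγ₀ : 1 < γ₀) (hγ : γ₀ < γbar)
    (g η : ℝ → ℝ) (hg1 : g 1 ≠ 0)
    (hη : ContinuousOn η (Set.Icc γ₀ γbar))
    (hscale : ∀ γ ∈ Set.Icc γ₀ γbar, ∀ x : ℝ, 0 < x → g (γ * x) = γ ^ (η γ) * g x) :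
    ∀ γ₁ ∈ Set.Icc γ₀ γbar, ∀ γ₂ ∈ Set.Icc γ₀ γbar, η γ₁ = η γ₂ := by
  intro γ₁ h₁ γ₂ h₂
  have hγ₁ : 1 < γ₁ := hγ₀.trans_le h₁.1
  have hpos : 0 < γ₁ := one_pos.trans hγ₁
  have hpos₀ : 0 < γ₀ := one_pos.trans hγ₀
  set a := Real.logb γ₁ γ₀
  set b := Real.logb γ₁ γbar
  have ha : 0 < a := Real.logb_pos hγ₁ hγ₀
  have hab : a < b := Real.logb_lt_logb hγ₁ hpos₀ hγ
  have hmaps : Set.MapsTo (fun r : ℝ => γ₁ ^ r) (Set.Icc a b) (Set.Icc γ₀ γbar) := fun r hr =>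
    ⟨(Real.logb_le_iff_le_rpow hγ₁ hpos₀).1 hr.1,
      (Real.le_logb_iff_rpow_le hγ₁ (hpos₀.trans hγ)).1 hr.2⟩
  have hcont : ContinuousOn (fun r : ℝ => η (γ₁ ^ r)) (Set.Icc a b) :=
    hη.comp (Real.continuous_const_rpow hpos.ne').continuousOn hmaps
  have hrat : Set.EqOn (fun _ => η γ₁) (fun r : ℝ => η (γ₁ ^ r))
      (Set.Ioo a b ∩ Set.range ((↑) : ℚ → ℝ)) := by
    rintro _ ⟨hq, q, rfl⟩
    have hq0 : 0 < q := by exact_mod_cast ha.trans hq.1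
    have hmem := hmaps (Set.Ioo_subset_Icc_self hq)
    have hnum : ((q.num.toNat : ℕ) : ℤ) = q.num := Int.toNat_of_nonneg (Rat.num_pos.2 hq0).le
    have hmul : (q : ℝ) * (q.den : ℝ) = (q.num.toNat : ℝ) := by
      have : q * q.den = ((q.num.toNat : ℤ) : ℚ) := by rw [hnum, Rat.mul_den_eq_num]
      exact_mod_cast this
    refine (scaling_exponent_eq_of_pow_eq hg1 (hγ₀.trans_le hmem.1) hγ₁
      (hscale _ hmem) (hscale _ h₁) q.den_nz (n := q.num.toNat) ?_).symm
    simp only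
    rw [← Real.rpow_mul_natCast hpos.le, hmul, Real.rpow_natCast]
  have hdense : Set.Icc a b ⊆ closure (Set.Ioo a b ∩ Set.range ((↑) : ℚ → ℝ)) := by
    rw [← closure_Ioo hab.ne]
    exact closure_minimal
      (Dense.open_subset_closure_inter Rat.denseRange_cast isOpen_Ioo) isClosed_closure
  have h := hrat.of_subset_closure continuousOn_const hcont
    (Set.inter_subset_left.trans Set.Ioo_subset_Icc_self) hdense
  have hpos₂ : 0 < γ₂ := hpos₀.trans_le h₂.1
  have := h (x := Real.logb γ₁ γ₂) ⟨Real.logb_le_logb_of_le hγ₁ hpos₀ h₂.1,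
    Real.logb_le_logb_of_le hγ₁ hpos₂ h₂.2⟩
  simpa only [Real.rpow_logb hpos hγ₁.ne' hpos₂] using this
end

section
/- Let η ∈ ℝ and let g : (0,∞) → ℝ satisfy g(γ·x) = γ^η · g(x) for every γ ∈ [2,4] and every x > 0. Then g(x) = x^η · g(1) for all x > 0. -/
/-- A function on `(0,∞)` that scales by `c ^ η` under multiplication by `c` is the expected
multiple of `g 1` at every integer power of `c`. -/
theorem apply_zpow_eq_rpow_mul_of_scaling {c η : ℝ} {g : ℝ → ℝ} (hc : 0 < c)
    (h : ∀ x : ℝ, 0 < x → g (c * x) = c ^ η * g x) (n : ℤ) :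
    g (c ^ n) = (c ^ n) ^ η * g 1 := by
  induction n using Int.induction_on with
  | zero => simp
  | succ k ih =>
    have hk : 0 < c ^ (k : ℤ) := zpow_pos hc _
    rw [zpow_add_one₀ hc.ne', mul_comm, h _ hk, ih, Real.mul_rpow hc.le hk.le, mul_assoc]
  | pred k ih =>
    have hk : 0 < c ^ (-(k : ℤ) - 1) := zpow_pos hc _
    have hstep : c ^ (-(k : ℤ)) = c * c ^ (-(k : ℤ) - 1) := by
      rw [← zpow_one_add₀ hc.ne']
      congr 1
      ring
    rw [hstep, h _ hk, Real.mul_rpow hc.le hk.le, mul_assoc] at ih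
    exact mul_left_cancel₀ (Real.rpow_pos_of_pos hc η).ne' ih

/-- If `g : (0,∞) → ℝ` satisfies `g(γ·x) = γ^η·g(x)` for every `γ ∈ [2,4]` and `x > 0`,
then `g(x) = x^η·g(1)` for all `x > 0`. -/
theorem stmt_1 (η : ℝ) (g : ℝ → ℝ)
    (h : ∀ γ ∈ Set.Icc (2:ℝ) 4, ∀ x : ℝ, 0 < x → g (γ * x) = γ ^ η * g x) :
    ∀ x : ℝ, 0 < x → g x = x ^ η * g 1 := by
  intro x hx
  obtain ⟨n, hn, hn'⟩ := exists_mem_Ico_zpow hx (one_lt_two : (1 : ℝ) < 2)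
  have hp : (0 : ℝ) < 2 ^ (n - 1) := zpow_pos two_pos _
  have hn₁ : (2 : ℝ) ^ n = 2 * 2 ^ (n - 1) := by
    rw [← zpow_one_add₀ two_ne_zero]
    congr 1
    ring
  rw [zpow_add_one₀ two_ne_zero] at hn'
  have hγ : x / 2 ^ (n - 1) ∈ Set.Icc (2 : ℝ) 4 :=
    ⟨by rw [le_div_iff₀ hp]; linarith, by rw [div_le_iff₀ hp]; linarith⟩
  have hx_eq := h _ hγ _ hp
  rwa [apply_zpow_eq_rpow_mul_of_scaling two_pos (h 2 (by norm_num)), ← mul_assoc,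
    ← Real.mul_rpow (div_pos hx hp).le hp.le, div_mul_cancel₀ _ hp.ne'] at hx_eq
end

section
/- The function (x,θ) ↦ 𝟙[x + 2·cos θ ≤ 0] · (x·cos(2θ) + cos θ)/(1 + 2x·cos θ + x²) is Lebesgue integrable on [0,1] × [0,2π] and its integral over [0,1] × [0,2π] is strictly negative. Here 𝟙[·] denotes the indicator function, and 1 + 2x cos θ + x² = |x e^{−iθ} + 1|². -/
open MeasureTheory

lemma mul_cos_two_mul_add_cos_sq_le (x θ : ℝ) :
    (x * Real.cos (2 * θ) + Real.cos θ) ^ 2 ≤ 1 + 2 * x * Real.cos θ + x ^ 2 := by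
  have h : 1 + 2 * x * Real.cos θ + x ^ 2 - (x * Real.cos (2 * θ) + Real.cos θ) ^ 2 =
      (x * Real.sin (2 * θ) + Real.sin θ) ^ 2 := by
    rw [Real.cos_two_mul, Real.sin_two_mul]
    have hs := Real.sin_sq_add_cos_sq θ
    grind
  linarith [sq_nonneg (x * Real.sin (2 * θ) + Real.sin θ)]

lemma mul_cos_two_mul_add_cos_nonpos {x θ : ℝ} (hx₀ : 0 ≤ x) (hx₁ : x ≤ 1)
    (h : x + 2 * Real.cos θ ≤ 0) : x * Real.cos (2 * θ) + Real.cos θ ≤ 0 := by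
  rw [Real.cos_two_mul]
  have hc := Real.neg_one_le_cos θ
  nlinarith [mul_nonneg hx₀ (mul_nonneg (neg_nonneg.2 h) (by linarith : 0 ≤ 1 + Real.cos θ)),
    mul_nonneg hx₀ (sub_nonneg.2 hx₁), mul_nonneg (sub_nonneg.2 hx₁) (neg_nonneg.2 h)]

lemma mul_cos_two_mul_add_cos_neg {x θ : ℝ} (hx₀ : 0 < x) (hx₁ : x < 1)
    (h : x + 2 * Real.cos θ ≤ 0) : x * Real.cos (2 * θ) + Real.cos θ < 0 := by
  rw [Real.cos_two_mul]
  have hc := Real.neg_one_le_cos θ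
  nlinarith [mul_nonneg hx₀.le (mul_nonneg (neg_nonneg.2 h) (by linarith : 0 ≤ 1 + Real.cos θ)),
    mul_pos hx₀ (sub_pos.2 hx₁), mul_nonneg (sub_nonneg.2 hx₁.le) (neg_nonneg.2 h)]

lemma mul_abs_sub_pi_le {x θ : ℝ} (hx₀ : 0 ≤ x) (hθ : |θ - Real.pi| ≤ Real.pi)
    (hc : Real.cos θ ≤ 0) :
    (1 - x) * |θ - Real.pi| ≤ 4 * (1 + 2 * x * Real.cos θ + x ^ 2) := by
  have h₁ := Real.neg_one_le_cos θ
  have hcos := Real.cos_le_one_sub_mul_cos_sq hθ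
  rw [Real.cos_sub_pi, ← sq_abs (θ - Real.pi)] at hcos
  have hpi : (1 : ℝ) / 8 ≤ 2 / Real.pi ^ 2 := by
    rw [div_le_div_iff₀ (by norm_num) (by positivity)]
    nlinarith [Real.pi_lt_four, Real.pi_pos]
  have hsq : |θ - Real.pi| ^ 2 / 8 ≤ 1 + Real.cos θ := by
    nlinarith [sq_nonneg |θ - Real.pi|]
  have hD : 1 + Real.cos θ ≤ 1 + 2 * x * Real.cos θ + x ^ 2 := by
    nlinarith [sq_nonneg (x + Real.cos θ)]
  have hD' : (1 - x) ^ 2 ≤ 1 + 2 * x * Real.cos θ + x ^ 2 := by nlinarith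
  nlinarith [sq_nonneg (2 * (1 - x) - |θ - Real.pi| / 2), sq_nonneg (1 - x),
    sq_nonneg |θ - Real.pi|, sq_nonneg ((1 - x) - |θ - Real.pi| / 2)]

lemma intervalIntegrable_abs_rpow {r : ℝ} (hr : -1 < r) (a b : ℝ) :
    IntervalIntegrable (fun x : ℝ => |x| ^ r) volume a b := by
  refine intervalIntegrable_of_even (fun x => by rw [abs_neg]) fun c hc => ?_
  refine (intervalIntegral.intervalIntegrable_rpow' hr (a := 0) (b := c)).congr fun x hx => ?_
  rw [Set.uIoc_of_le hc.le] at hx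
  simp only [abs_of_pos hx.1]

lemma integrableOn_abs_sub_rpow {r a b : ℝ} (hr : -1 < r) (hab : a ≤ b) (c : ℝ) :
    IntegrableOn (fun x : ℝ => |x - c| ^ r) (Set.Icc a b) volume := by
  rw [← intervalIntegrable_iff_integrableOn_Icc_of_le hab]
  simpa using (intervalIntegrable_abs_rpow hr (a - c) (b - c)).comp_sub_right c

/-- The function `(x,θ) ↦ 𝟙[x + 2cos θ ≤ 0]·(x cos 2θ + cos θ)/(1 + 2x cos θ + x²)` is
Lebesgue integrable on `[0,1] × [0,2π]` and its integral is strictly negative. -/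
theorem stmt_6 :
    IntegrableOn
      (fun p : ℝ × ℝ =>
        if p.1 + 2 * Real.cos p.2 ≤ 0 then
          (p.1 * Real.cos (2 * p.2) + Real.cos p.2) / (1 + 2 * p.1 * Real.cos p.2 + p.1 ^ 2)
        else 0)
      (Set.Icc (0:ℝ) 1 ×ˢ Set.Icc (0:ℝ) (2 * Real.pi)) volume ∧
    (∫ p in Set.Icc (0:ℝ) 1 ×ˢ Set.Icc (0:ℝ) (2 * Real.pi),
        (if p.1 + 2 * Real.cos p.2 ≤ 0 then
          (p.1 * Real.cos (2 * p.2) + Real.cos p.2) / (1 + 2 * p.1 * Real.cos p.2 + p.1 ^ 2)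
        else 0)) < 0 := by
  set f : ℝ × ℝ → ℝ := fun p =>
    if p.1 + 2 * Real.cos p.2 ≤ 0 then
      (p.1 * Real.cos (2 * p.2) + Real.cos p.2) / (1 + 2 * p.1 * Real.cos p.2 + p.1 ^ 2)
    else 0 with hf
  set S : Set (ℝ × ℝ) := Set.Icc (0:ℝ) 1 ×ˢ Set.Icc (0:ℝ) (2 * Real.pi) with hS
  have hSm : MeasurableSet S := measurableSet_Icc.prod measurableSet_Icc
  have hfm : Measurable f := by
    refine Measurable.ite (measurableSet_le (by fun_prop) (by fun_prop)) (by fun_prop) (by fun_prop)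
  have hint : IntegrableOn f S volume := by
    have hg : IntegrableOn
        (fun p : ℝ × ℝ => 2 * (|p.1 - 1| ^ (-1 / 2 : ℝ) * |p.2 - Real.pi| ^ (-1 / 2 : ℝ)))
        S volume := by
      rw [IntegrableOn, hS, Measure.volume_eq_prod, ← Measure.prod_restrict]
      exact ((integrableOn_abs_sub_rpow (by norm_num) zero_le_one 1).mul_prod
        (integrableOn_abs_sub_rpow (by norm_num) Real.two_pi_pos.le Real.pi)).const_mul 2
    refine hg.mono' hfm.aestronglyMeasurable ?_
    have h₁ : ∀ᵐ p : ℝ × ℝ, p.1 ≠ 1 :=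
      Measure.quasiMeasurePreserving_fst.ae (Measure.ae_ne volume 1)
    have h₂ : ∀ᵐ p : ℝ × ℝ, p.2 ≠ Real.pi :=
      Measure.quasiMeasurePreserving_snd.ae (Measure.ae_ne volume Real.pi)
    filter_upwards [ae_restrict_mem hSm, ae_restrict_of_ae h₁, ae_restrict_of_ae h₂]
      with ⟨x, θ⟩ ⟨⟨hx₀, hx₁⟩, hθ₀, hθ₁⟩ hx hθ
    simp only at hx₀ hx₁ hθ₀ hθ₁ hx hθ
    simp only [hf]
    split_ifs with h
    · have hle := mul_abs_sub_pi_le hx₀ (abs_le.2 ⟨by linarith, by linarith⟩)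
        (by linarith : Real.cos θ ≤ 0)
      have hN := mul_cos_two_mul_add_cos_sq_le x θ
      have ht : 0 < |x - 1| := abs_pos.2 (sub_ne_zero.2 hx)
      have hφ : 0 < |θ - Real.pi| := abs_pos.2 (sub_ne_zero.2 hθ)
      rw [← abs_of_nonneg (sub_nonneg.2 hx₁), abs_sub_comm] at hle
      set N := x * Real.cos (2 * θ) + Real.cos θ
      set D := 1 + 2 * x * Real.cos θ + x ^ 2
      have hD : 0 < D := by nlinarith [mul_pos ht hφ]
      rw [← Real.mul_rpow ht.le hφ.le, neg_div, Real.rpow_neg (by positivity),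
        ← Real.sqrt_eq_rpow, Real.norm_eq_abs, abs_div, abs_of_pos hD, ← div_eq_mul_inv,
        div_le_div_iff₀ hD (Real.sqrt_pos.2 (mul_pos ht hφ))]
      have hsD : √(|x - 1| * |θ - Real.pi|) ≤ 2 * √D := by
        rw [Real.sqrt_le_left (by positivity), mul_pow, Real.sq_sqrt hD.le]
        linarith
      calc |N| * √(|x - 1| * |θ - Real.pi|) ≤ √D * (2 * √D) :=
            mul_le_mul (Real.abs_le_sqrt hN) hsD (Real.sqrt_nonneg _) (Real.sqrt_nonneg _)
        _ = 2 * D := by rw [mul_left_comm, Real.mul_self_sqrt hD.le]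
    · rw [norm_zero]
      positivity
  refine ⟨hint, ?_⟩
  have hnonneg : 0 ≤ᵐ[volume.restrict S] fun p => -f p := by
    filter_upwards [ae_restrict_mem hSm] with ⟨x, θ⟩ ⟨⟨hx₀, hx₁⟩, _⟩
    simp only [hf, Pi.zero_apply, neg_nonneg]
    split_ifs with h
    · exact div_nonpos_of_nonpos_of_nonneg (mul_cos_two_mul_add_cos_nonpos hx₀ hx₁ h)
        ((sq_nonneg _).trans (mul_cos_two_mul_add_cos_sq_le x θ))
    · exact le_rfl
  have hpos : 0 < ∫ p in S, -f p := by
    rw [setIntegral_pos_iff_support_of_nonneg_ae hnonneg hint.neg]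
    have hpi := Real.pi_pos
    have hopen : IsOpen (Set.Ioo (0:ℝ) 1 ×ˢ Set.Ioo (Real.pi - Real.pi / 3) Real.pi) :=
      isOpen_Ioo.prod isOpen_Ioo
    refine (hopen.measure_pos volume ?_).trans_le (measure_mono ?_)
    · exact (Set.nonempty_Ioo.2 one_pos).prod (Set.nonempty_Ioo.2 (by linarith))
    · rintro ⟨x, θ⟩ ⟨⟨hx₀, hx₁⟩, hθ₀, hθ₁⟩
      simp only at hx₀ hx₁ hθ₀ hθ₁
      refine ⟨?_, ⟨hx₀.le, hx₁.le⟩, by simp only; linarith, by simp only; linarith⟩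
      have hcos : Real.cos θ < -(1 / 2) := by
        rw [← Real.cos_pi_div_three, ← Real.cos_pi_sub]
        exact Real.cos_lt_cos_of_nonneg_of_le_pi (by linarith) hθ₁.le hθ₀
      have h : x + 2 * Real.cos θ ≤ 0 := by linarith
      have hN := mul_cos_two_mul_add_cos_neg hx₀ hx₁ h
      simp only [hf, Function.mem_support, if_pos h, neg_ne_zero]
      exact div_ne_zero hN.ne
        ((pow_pos (neg_pos.2 hN) 2).trans_le
          ((neg_sq _).trans_le (mul_cos_two_mul_add_cos_sq_le x θ))).ne'
  rw [integral_neg] at hpos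
  exact neg_pos.1 hpos
end

section
/- Let γ > 1, N ∈ ℤ, and let β : ℤ → ℝ be bounded on {j : j ≤ N+1}. Suppose ν : ℤ → ℝ satisfies ν_{j−1} = γ·ν_j + β_j for every j ≤ N+1 and ν_j → 0 as j → −∞. Then for every j ≤ N+1 the series Σ_{k=−∞}^{j} γ^{k−j−1}·β_k converges absolutely and ν_j = −Σ_{k=−∞}^{j} γ^{k−j−1}·β_k. -/
/-- Iterating the backward flow `ν (k - 1) = γ * ν k + β k` down from scale `j` for `m` steps. -/
theorem sum_range_backward_flow {γ : ℝ} (hγ : γ ≠ 0) {β ν : ℤ → ℝ} {j : ℤ}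
    (hflow : ∀ k : ℤ, k ≤ j → ν (k - 1) = γ * ν k + β k) (m : ℕ) :
    ∑ n ∈ Finset.range m, γ⁻¹ ^ (n + 1) * β (j - (n : ℤ)) = γ⁻¹ ^ m * ν (j - (m : ℤ)) - ν j := by
  induction m with
  | zero => simp
  | succ m ih =>
    have hstep := hflow (j - (m : ℤ)) (by omega)
    rw [Finset.sum_range_succ, ih, Nat.cast_succ, ← sub_sub, hstep]
    linear_combination -γ⁻¹ ^ m * ν (j - (m : ℤ)) * mul_inv_cancel₀ hγ

/-- If `ν_{j−1} = γ ν_j + β_j` for all `j ≤ N+1`, `β` is bounded on `{j ≤ N+1}` and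
`ν_j → 0` as `j → −∞`, then for every `j ≤ N+1` the series `Σ_{k=−∞}^{j} γ^{k−j−1} β_k`
(parametrized by `k = j − n`, `n ∈ ℕ`) converges absolutely and
`ν_j = −Σ_{k=−∞}^{j} γ^{k−j−1} β_k`. -/
theorem stmt_14 (γ : ℝ) (hγ : 1 < γ) (N : ℤ) (β ν : ℤ → ℝ)
    (hβ : ∃ M : ℝ, ∀ j : ℤ, j ≤ N + 1 → |β j| ≤ M)
    (hflow : ∀ j : ℤ, j ≤ N + 1 → ν (j - 1) = γ * ν j + β j)
    (hlim : Filter.Tendsto ν Filter.atBot (nhds 0)) :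
    ∀ j : ℤ, j ≤ N + 1 →
      Summable (fun n : ℕ => |γ ^ ((j - (n:ℤ)) - j - 1) * β (j - (n:ℤ))|) ∧
      ν j = -∑' n : ℕ, γ ^ ((j - (n:ℤ)) - j - 1) * β (j - (n:ℤ)) := by
  intro j hj
  obtain ⟨M, hM⟩ := hβ
  have hγ0 : 0 < γ := one_pos.trans hγ
  have hinv0 : 0 ≤ γ⁻¹ := (inv_pos.2 hγ0).le
  have hinv1 : γ⁻¹ < 1 := inv_lt_one_of_one_lt₀ hγ
  have hpow (n : ℕ) : γ ^ ((j - (n : ℤ)) - j - 1) = γ⁻¹ ^ (n + 1) := by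
    rw [show (j - (n : ℤ)) - j - 1 = -((n + 1 : ℕ) : ℤ) by push_cast; ring, zpow_neg,
      zpow_natCast, inv_pow]
  simp only [hpow]
  have hsum : Summable fun n : ℕ => |γ⁻¹ ^ (n + 1) * β (j - (n : ℤ))| := by
    have hgeom : Summable fun n : ℕ => γ⁻¹ ^ (n + 1) * M :=
      ((summable_nat_add_iff 1).2 (summable_geometric_of_lt_one hinv0 hinv1)).mul_right M
    refine hgeom.of_nonneg_of_le (fun n => abs_nonneg _) fun n => ?_
    rw [abs_mul, abs_of_nonneg (pow_nonneg hinv0 _)]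
    exact mul_le_mul_of_nonneg_left (hM _ (by omega)) (pow_nonneg hinv0 _)
  refine ⟨hsum, ?_⟩
  have hbot : Filter.Tendsto (fun m : ℕ => j - (m : ℤ)) Filter.atTop Filter.atBot :=
    Filter.tendsto_atBot.2 fun b => by
      filter_upwards [Filter.eventually_ge_atTop (j - b).toNat] with m hm
      omega
  have hpartial : Filter.Tendsto (fun m : ℕ => γ⁻¹ ^ m * ν (j - (m : ℤ)) - ν j)
      Filter.atTop (nhds (-ν j)) := by
    simpa using ((tendsto_pow_atTop_nhds_zero_of_lt_one hinv0 hinv1).mul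
      (hlim.comp hbot)).sub_const (ν j)
  have htsum := hsum.of_abs.hasSum.tendsto_sum_nat
  simp only [sum_range_backward_flow hγ0.ne' fun k hk => hflow k (hk.trans hj)] at htsum
  rw [tendsto_nhds_unique htsum hpartial, neg_neg]
end

section
/- Let η ∈ (0,2), R ≥ 0, L ≥ 0, M ≥ 0. Let φ : ℝ² → ℝ be Lipschitz with constant L and satisfy φ(p) = 0 for |p| ≥ R, and let F : ℝ² → ℂ be measurable with |F(p)| ≤ M for all p. Then for every a ∈ ℝ², the function p ↦ |p|^{η−2}·F(p)·(φ(p+a) − φ(p)) is Lebesgue integrable on ℝ² and |∫_{ℝ²} |p|^{η−2}·F(p)·(φ(p+a) − φ(p)) dp| ≤ (2π/η)·M·L·|a|·(R+|a|)^η. -/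
open MeasureTheory

theorem setIntegral_Ioi_indicator_Iio_mul_rpow {η T : ℝ} (hη : 0 < η) (hT : 0 ≤ T) :
    IntegrableOn (fun r : ℝ => r * (Set.Iio T).indicator (fun r => r ^ (η - 2)) r) (Set.Ioi 0) ∧
    ∫ r in Set.Ioi (0 : ℝ), r * (Set.Iio T).indicator (fun r => r ^ (η - 2)) r = T ^ η / η := by
  have hpow : Set.EqOn (fun r : ℝ => r * (Set.Iio T).indicator (fun r => r ^ (η - 2)) r)
      ((Set.Iio T).indicator fun r => r ^ (η - 1)) (Set.Ioi 0) := by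
    intro r hr
    by_cases h : r ∈ Set.Iio T
    · simp only [Set.indicator_of_mem h]
      rw [mul_comm, ← Real.rpow_add_one (ne_of_gt hr)]
      ring_nf
    · simp only [Set.indicator_of_notMem h, mul_zero]
  have hint : IntervalIntegrable (fun r : ℝ => r ^ (η - 1)) volume 0 T :=
    intervalIntegral.intervalIntegrable_rpow' (by linarith)
  have hset : Set.Ioi (0 : ℝ) ∩ Set.Iio T = Set.Ioo 0 T := rfl
  constructor
  · rw [integrableOn_congr_fun hpow measurableSet_Ioi, IntegrableOn,
      integrable_indicator_iff measurableSet_Iio, IntegrableOn,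
      Measure.restrict_restrict measurableSet_Iio, Set.inter_comm, hset]
    exact (intervalIntegrable_iff_integrableOn_Ioo_of_le hT).1 hint
  · rw [setIntegral_congr_fun measurableSet_Ioi hpow, setIntegral_indicator measurableSet_Iio,
      hset, ← integral_Ioc_eq_integral_Ioo, ← intervalIntegral.integral_of_le hT,
      integral_rpow (Or.inl (by linarith))]
    simp [Real.zero_rpow hη.ne']

theorem integral_indicator_Iio_norm_rpow {η T : ℝ} (hη : 0 < η) (hT : 0 ≤ T) :
    Integrable (fun p : EuclideanSpace ℝ (Fin 2) =>
      (Set.Iio T).indicator (fun r => r ^ (η - 2)) ‖p‖) ∧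
    ∫ p : EuclideanSpace ℝ (Fin 2), (Set.Iio T).indicator (fun r => r ^ (η - 2)) ‖p‖ =
      2 * Real.pi / η * T ^ η := by
  obtain ⟨hi, hv⟩ := setIntegral_Ioi_indicator_Iio_mul_rpow hη hT
  have hdim : Module.finrank ℝ (EuclideanSpace ℝ (Fin 2)) - 1 = 1 := by simp
  constructor
  · rw [integrable_fun_norm_addHaar volume, hdim]
    simpa only [pow_one, smul_eq_mul] using hi
  · rw [integral_fun_norm_addHaar volume, hdim]
    simp only [pow_one, smul_eq_mul, hv, finrank_euclideanSpace, Fintype.card_fin, nsmul_eq_mul,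
      Measure.real, EuclideanSpace.volume_ball_fin_two]
    simp only [ENNReal.ofReal_one, one_pow, one_mul, ENNReal.toReal_ofReal Real.pi_pos.le]
    push_cast
    ring

/-- A difference of translates of a Lipschitz function supported in the ball of radius `R` is
small and supported in the ball of radius `R + ‖a‖`. -/
theorem norm_rpow_mul_mul_sub_le {E : Type*} [SeminormedAddCommGroup E] {R L M s : ℝ}
    (hL : 0 ≤ L) (hM : 0 ≤ M) {φ : E → ℝ} (hφ : LipschitzWith L.toNNReal φ)
    (hφ0 : ∀ p, R ≤ ‖p‖ → φ p = 0) {F : E → ℂ} (hF : ∀ p, ‖F p‖ ≤ M) (a p : E) :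
    ‖((‖p‖ ^ s : ℝ) : ℂ) * F p * ((φ (p + a) - φ p : ℝ) : ℂ)‖ ≤
      M * L * ‖a‖ * (Set.Iio (R + ‖a‖)).indicator (fun r => r ^ s) ‖p‖ := by
  by_cases h : ‖p‖ ∈ Set.Iio (R + ‖a‖)
  · have hd : |φ (p + a) - φ p| ≤ L * ‖a‖ := by
      simpa [Real.coe_toNNReal _ hL, Real.dist_eq] using hφ.dist_le_mul (p + a) p
    have hs : 0 ≤ ‖p‖ ^ s := Real.rpow_nonneg (norm_nonneg p) _
    rw [Set.indicator_of_mem h, norm_mul, norm_mul, Complex.norm_real, Complex.norm_real,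
      Real.norm_of_nonneg hs, Real.norm_eq_abs]
    calc ‖p‖ ^ s * ‖F p‖ * |φ (p + a) - φ p| ≤ ‖p‖ ^ s * M * (L * ‖a‖) := by
          gcongr
          exact hF p
      _ = M * L * ‖a‖ * ‖p‖ ^ s := by ring
  · have hp : R + ‖a‖ ≤ ‖p‖ := not_lt.1 h
    have hpa : ‖p‖ ≤ ‖p + a‖ + ‖a‖ := by simpa using norm_sub_le (p + a) a
    rw [Set.indicator_of_notMem h, hφ0 p (by linarith [norm_nonneg a]),
      hφ0 (p + a) (by linarith)]
    simp

/-- If `φ : ℝ² → ℝ` is `L`-Lipschitz and vanishes for `|p| ≥ R`, and `F : ℝ² → ℂ` is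
measurable with `|F| ≤ M`, then for `η ∈ (0,2)` and every `a ∈ ℝ²` the function
`p ↦ |p|^{η−2} F(p) (φ(p+a) − φ(p))` is Lebesgue integrable on `ℝ²` and
`|∫ |p|^{η−2} F(p)(φ(p+a) − φ(p)) dp| ≤ (2π/η) M L |a| (R+|a|)^η`. -/
theorem stmt_17 (η R L M : ℝ) (hη0 : 0 < η) (hη2 : η < 2)
    (hR : 0 ≤ R) (hL : 0 ≤ L) (hM : 0 ≤ M)
    (φ : EuclideanSpace ℝ (Fin 2) → ℝ) (hφ : LipschitzWith (Real.toNNReal L) φ)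
    (hφ0 : ∀ p : EuclideanSpace ℝ (Fin 2), R ≤ ‖p‖ → φ p = 0)
    (F : EuclideanSpace ℝ (Fin 2) → ℂ)
    (hFmeas : Measurable F) (hF : ∀ p, ‖F p‖ ≤ M)
    (a : EuclideanSpace ℝ (Fin 2)) :
    Integrable (fun p : EuclideanSpace ℝ (Fin 2) =>
      ((‖p‖ ^ (η - 2) : ℝ) : ℂ) * F p * ((φ (p + a) - φ p : ℝ) : ℂ)) ∧
    ‖∫ p : EuclideanSpace ℝ (Fin 2),
        ((‖p‖ ^ (η - 2) : ℝ) : ℂ) * F p * ((φ (p + a) - φ p : ℝ) : ℂ)‖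
      ≤ (2 * Real.pi / η) * M * L * ‖a‖ * (R + ‖a‖) ^ η := by
  obtain ⟨hi, hv⟩ := integral_indicator_Iio_norm_rpow (T := R + ‖a‖) hη0 (by positivity)
  have hbound := norm_rpow_mul_mul_sub_le (s := η - 2) hL hM hφ hφ0 hF a
  have hφm : Measurable φ := hφ.continuous.measurable
  refine ⟨(hi.const_mul (M * L * ‖a‖)).mono' ?_ (.of_forall hbound), ?_⟩
  · exact Measurable.aestronglyMeasurable (by fun_prop)
  · refine (norm_integral_le_of_norm_le (hi.const_mul _) (.of_forall hbound)).trans_eq ?_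
    rw [integral_const_mul, hv]
    ring
end
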